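/- Let Ω₀ = {x ∈ ℝ³ : |x| < 1}, d(x) = (1/4)(1 − |x|²), and let α : [0,∞) → (0,∞) be continuously differentiable with α(0) = 1. Let η : Ω₀ × [0,∞) → ℝ³ be C³ with η(x,0) = x, invertible spatial Jacobian ∇η(x,t) everywhere, v = ∂_t η, u₀ = v(·,0), A = (∇η)⁻¹, J = det ∇η, δη(x,t) = η(x,t) − x, and suppose the γ = 2 momentum equation α⁵ ∂_t vⁱ + 2 α⁴ α' vⁱ + ηⁱ + 2 Aᵏᵢ ∂_k( d · J⁻¹ ) = 0 holds on Ω₀ × (0,∞) for each i. Set β(t) = ∫₀ᵗ α(s)^{−2} ds. Then for every t ≥ 0 and x ∈ Ω₀ and each component i: (curl δη)ᵢ(x,t) = β(t) (curl u₀)ᵢ(x) + ε_{ikj} ∫₀ᵗ ∂_r vᵏ (Aʳⱼ − δʳⱼ)(x,s) ds + ε_{ikj} ∫₀ᵗ α(s)^{−2} ∫₀ˢ α(τ)² ∂_r vᵏ Aʳₗ ∂_m vˡ Aᵐⱼ (x,τ) dτ ds (summation over repeated indices, δʳⱼ the Kronecker delta). -/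

import Mathlib

open Set Matrix intervalIntegral

noncomputable section

/-- Partial derivative `∂_k f` of a scalar function on `ℝ³` (realized as `Fin 3 → ℝ`). -/
def pd (k : Fin 3) (f : (Fin 3 → ℝ) → ℝ) (x : Fin 3 → ℝ) : ℝ :=
  fderiv ℝ f x (Pi.single k 1)

/-- The open unit ball `Ω₀ = {x ∈ ℝ³ : |x| < 1}` (Euclidean norm). -/
def ball3 : Set (Fin 3 → ℝ) := {x | ∑ i, x i ^ 2 < 1}

/-- The weight function `d(x) = (1/4)(1 − |x|²)`. -/
def dw (x : Fin 3 → ℝ) : ℝ := (1 - ∑ i, x i ^ 2) / 4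

/-- The spatial Jacobian matrix `∇η(·,t)` of a time-dependent map `η`. -/
def jacT (η : (Fin 3 → ℝ) → ℝ → Fin 3 → ℝ) (x : Fin 3 → ℝ) (t : ℝ) :
    Matrix (Fin 3) (Fin 3) ℝ :=
  Matrix.of fun i k => pd k (fun y => η y t i) x

/-- The permutation (Levi-Civita) symbol `ε_{ijk}` on `Fin 3`. -/
def eps (i j k : Fin 3) : ℝ :=
  (((i : ℕ) : ℝ) - ((j : ℕ) : ℝ)) * (((j : ℕ) : ℝ) - ((k : ℕ) : ℝ)) *
    (((k : ℕ) : ℝ) - ((i : ℕ) : ℝ)) / 2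

open Filter Topology

theorem isOpen_ball3 : IsOpen ball3 :=
  isOpen_lt (by fun_prop) continuous_const

theorem uniqueDiffOn_ball3_prod : UniqueDiffOn ℝ (ball3 ×ˢ Ici (0 : ℝ)) :=
  isOpen_ball3.uniqueDiffOn.prod (uniqueDiffOn_Ici 0)

theorem ball3_prod_subset_closure :
    ball3 ×ˢ Ici (0 : ℝ) ⊆ closure (interior (ball3 ×ˢ Ici (0 : ℝ))) := by
  rw [interior_prod_eq, closure_prod_eq, interior_Ici, closure_Ioi, isOpen_ball3.interior_eq]
  exact prod_mono subset_closure le_rfl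

section SpaceTime

variable {f g : (Fin 3 → ℝ) → ℝ → ℝ} {x : Fin 3 → ℝ} {t : ℝ}

theorem hasFDerivAt_slice {F : (Fin 3 → ℝ) × ℝ → ℝ} {F' : (Fin 3 → ℝ) × ℝ →L[ℝ] ℝ}
    (hF : HasFDerivWithinAt F F' (ball3 ×ˢ Ici 0) (x, t)) (hx : x ∈ ball3) (ht : t ∈ Ici (0 : ℝ)) :
    HasFDerivAt (fun y => F (y, t)) (F'.comp (ContinuousLinearMap.inl ℝ (Fin 3 → ℝ) ℝ)) x :=
  (HasFDerivWithinAt.comp x (f := fun y => (y, t)) hF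
    (hasFDerivAt_prodMk_left x t).hasFDerivWithinAt
    (fun _ hy => ⟨hy, ht⟩)).hasFDerivAt (isOpen_ball3.mem_nhds hx)

theorem hasDerivWithinAt_slice {F : (Fin 3 → ℝ) × ℝ → ℝ} {F' : (Fin 3 → ℝ) × ℝ →L[ℝ] ℝ}
    (hF : HasFDerivWithinAt F F' (ball3 ×ˢ Ici 0) (x, t)) (hx : x ∈ ball3) :
    HasDerivWithinAt (fun s => F (x, s)) (F' (0, 1)) (Ici 0) t :=
  HasFDerivWithinAt.comp_hasDerivWithinAt t (f := fun s => (x, s)) hF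
    ((hasDerivWithinAt_const t _ x).prodMk (hasDerivWithinAt_id t _)) (fun _ hs => ⟨hx, hs⟩)

theorem pd_slice_eq {F : (Fin 3 → ℝ) × ℝ → ℝ} {n : WithTop ℕ∞}
    (hF : ContDiffOn ℝ n F (ball3 ×ˢ Ici 0)) (hn : n ≠ 0)
    (r : Fin 3) {p : (Fin 3 → ℝ) × ℝ} (hp : p ∈ ball3 ×ˢ Ici (0 : ℝ)) :
    pd r (fun y => F (y, p.2)) p.1 = fderivWithin ℝ F (ball3 ×ˢ Ici 0) p (Pi.single r 1, 0) := by
  have h := (hF.differentiableOn hn p hp).hasFDerivWithinAt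
  rw [pd, (hasFDerivAt_slice h hp.1 hp.2).fderiv]
  simp

theorem timeDeriv_eq {n : WithTop ℕ∞}
    (hf : ContDiffOn ℝ n (fun p : (Fin 3 → ℝ) × ℝ => f p.1 p.2) (ball3 ×ˢ Ici 0)) (hn : n ≠ 0)
    (hg : ∀ x ∈ ball3, ∀ t ∈ Ici (0 : ℝ), HasDerivWithinAt (f x) (g x t) (Ici 0) t)
    {p : (Fin 3 → ℝ) × ℝ} (hp : p ∈ ball3 ×ˢ Ici (0 : ℝ)) :
    g p.1 p.2 = fderivWithin ℝ (fun p : (Fin 3 → ℝ) × ℝ => f p.1 p.2) (ball3 ×ˢ Ici 0) p (0, 1) :=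
  (uniqueDiffOn_Ici 0 p.2 hp.2).eq_deriv _ (hg p.1 hp.1 p.2 hp.2)
    (hasDerivWithinAt_slice (hf.differentiableOn hn p hp).hasFDerivWithinAt hp.1)

theorem contDiffOn_timeDeriv {m n : WithTop ℕ∞}
    (hf : ContDiffOn ℝ n (fun p : (Fin 3 → ℝ) × ℝ => f p.1 p.2) (ball3 ×ˢ Ici 0))
    (hmn : m + 1 ≤ n)
    (hg : ∀ x ∈ ball3, ∀ t ∈ Ici (0 : ℝ), HasDerivWithinAt (f x) (g x t) (Ici 0) t) :
    ContDiffOn ℝ m (fun p : (Fin 3 → ℝ) × ℝ => g p.1 p.2) (ball3 ×ˢ Ici 0) := by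
  have hn : n ≠ 0 := by rintro rfl; simp at hmn
  refine ContDiffOn.congr ?_ (fun p hp => timeDeriv_eq hf hn hg hp)
  exact (hf.fderivWithin uniqueDiffOn_ball3_prod hmn).clm_apply contDiffOn_const

/-- Spatial partial derivatives commute with the time derivative. -/
theorem hasDerivWithinAt_pd
    (hf : ContDiffOn ℝ 2 (fun p : (Fin 3 → ℝ) × ℝ => f p.1 p.2) (ball3 ×ˢ Ici 0))
    (hg : ∀ x ∈ ball3, ∀ t ∈ Ici (0 : ℝ), HasDerivWithinAt (f x) (g x t) (Ici 0) t)
    (hx : x ∈ ball3) (ht : t ∈ Ici (0 : ℝ)) (r : Fin 3) :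
    HasDerivWithinAt (fun s => pd r (fun y => f y s) x) (pd r (fun y => g y t) x) (Ici 0) t := by
  set F : (Fin 3 → ℝ) × ℝ → ℝ := fun p => f p.1 p.2 with hF
  set S : Set ((Fin 3 → ℝ) × ℝ) := ball3 ×ˢ Ici (0 : ℝ) with hS
  have hp : (x, t) ∈ S := ⟨hx, ht⟩
  have hsymm := (hf (x, t) hp).isSymmSndFDerivWithinAt (by simp)
    uniqueDiffOn_ball3_prod (ball3_prod_subset_closure hp) hp
  have hD : ∀ e, HasFDerivWithinAt (fun p => fderivWithin ℝ F S p e)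
      ((fderivWithin ℝ (fderivWithin ℝ F S) S (x, t)).flip e) S (x, t) := fun e => by
    have := (((hf.fderivWithin (m := 1) uniqueDiffOn_ball3_prod (by norm_num)).differentiableOn
      (by simp) (x, t) hp).hasFDerivWithinAt).clm_apply (hasFDerivWithinAt_const e _ _)
    simpa using this
  have h1 := hasDerivWithinAt_slice (hD (Pi.single r 1, 0)) hx
  have h2 := (hasFDerivAt_slice (hD (0, 1)) hx ht).fderiv
  have h3 : pd r (fun y => g y t) x
      = (fderivWithin ℝ (fderivWithin ℝ F S) S (x, t)).flip (Pi.single r 1, 0) (0, 1) := by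
    have he : (fun y => g y t) =ᶠ[𝓝 x] fun y => fderivWithin ℝ F S (y, t) (0, 1) := by
      filter_upwards [isOpen_ball3.mem_nhds hx] with y hy
      exact timeDeriv_eq hf (by simp) hg (p := (y, t)) ⟨hy, ht⟩
    rw [pd, he.fderiv_eq, h2]
    simpa using hsymm (Pi.single r 1, 0) (0, 1)
  rw [h3]
  exact h1.congr (fun s hs => pd_slice_eq hf (by simp) r (p := (x, s)) ⟨hx, hs⟩)
    (pd_slice_eq hf (by simp) r (p := (x, t)) hp)

theorem contDiffAt_slice {n : WithTop ℕ∞}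
    (hf : ContDiffOn ℝ n (fun p : (Fin 3 → ℝ) × ℝ => f p.1 p.2) (ball3 ×ˢ Ici 0))
    (hx : x ∈ ball3) (ht : t ∈ Ici (0 : ℝ)) : ContDiffAt ℝ n (fun y => f y t) x :=
  (hf.comp (s := ball3) (f := fun y => (y, t)) (by fun_prop)
    (fun _ hy => ⟨hy, ht⟩)).contDiffAt (isOpen_ball3.mem_nhds hx)

end SpaceTime

theorem pd_pd_comm {f : (Fin 3 → ℝ) → ℝ} {x : Fin 3 → ℝ} (hf : ContDiffAt ℝ 2 f x)
    (r k : Fin 3) : pd r (pd k f) x = pd k (pd r f) x := by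
  have hs := hf.isSymmSndFDerivAt (by simp)
  have hd : DifferentiableAt ℝ (fderiv ℝ f) x :=
    (hf.fderiv_right (m := 1) (by norm_num)).differentiableAt (by simp)
  have h : ∀ r k, pd r (pd k f) x = fderiv ℝ (fderiv ℝ f) x (Pi.single r 1) (Pi.single k 1) := by
    intro r k
    have := (hd.hasFDerivAt.clm_apply (hasFDerivAt_const (Pi.single k (1 : ℝ)) x)).fderiv
    change fderiv ℝ (fun y => fderiv ℝ f y (Pi.single k 1)) x _ = _
    rw [this]; simp
  rw [h, h]
  exact hs _ _

theorem contDiffAt_pd {f : (Fin 3 → ℝ) → ℝ} {x : Fin 3 → ℝ} {m n : WithTop ℕ∞}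
    (hf : ContDiffAt ℝ n f x) (hmn : m + 1 ≤ n) (k : Fin 3) : ContDiffAt ℝ m (pd k f) x :=
  (hf.fderiv_right hmn).clm_apply contDiffAt_const

theorem pd_add {f g : (Fin 3 → ℝ) → ℝ} {x : Fin 3 → ℝ} (hf : DifferentiableAt ℝ f x)
    (hg : DifferentiableAt ℝ g x) (k : Fin 3) :
    pd k (fun y => f y + g y) x = pd k f x + pd k g x := by
  simp [pd, fderiv_fun_add hf hg]

theorem pd_mul {f g : (Fin 3 → ℝ) → ℝ} {x : Fin 3 → ℝ} (hf : DifferentiableAt ℝ f x)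
    (hg : DifferentiableAt ℝ g x) (k : Fin 3) :
    pd k (fun y => f y * g y) x = pd k f x * g x + f x * pd k g x := by
  simp [pd, fderiv_fun_mul hf hg]; ring

theorem pd_sum {ι : Type*} {s : Finset ι} {f : ι → (Fin 3 → ℝ) → ℝ} {x : Fin 3 → ℝ}
    (hf : ∀ i ∈ s, DifferentiableAt ℝ (f i) x) (k : Fin 3) :
    pd k (fun y => ∑ i ∈ s, f i y) x = ∑ i ∈ s, pd k (f i) x := by
  simp [pd, fderiv_fun_sum hf]

theorem pd_const_mul {f : (Fin 3 → ℝ) → ℝ} {x : Fin 3 → ℝ} (c : ℝ)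
    (hf : DifferentiableAt ℝ f x) (k : Fin 3) :
    pd k (fun y => c * f y) x = c * pd k f x := by
  simp [pd, fderiv_const_mul hf]

theorem pd_congr {f g : (Fin 3 → ℝ) → ℝ} {x : Fin 3 → ℝ} (hx : x ∈ ball3)
    (h : ∀ y ∈ ball3, f y = g y) (k : Fin 3) : pd k f x = pd k g x := by
  have he : f =ᶠ[𝓝 x] g := by
    filter_upwards [isOpen_ball3.mem_nhds hx] with y hy using h y hy
  rw [pd, pd, he.fderiv_eq]

theorem pd_coord (j k : Fin 3) (x : Fin 3 → ℝ) :
    pd j (fun y => y k) x = (1 : Matrix (Fin 3) (Fin 3) ℝ) k j := by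
  simp [pd, fderiv_apply, Matrix.one_apply, Pi.single_apply]

theorem contDiffAt_det {M : (Fin 3 → ℝ) → Matrix (Fin 3) (Fin 3) ℝ} {x : Fin 3 → ℝ}
    {n : WithTop ℕ∞} (hM : ∀ i j, ContDiffAt ℝ n (fun y => M y i j) x) :
    ContDiffAt ℝ n (fun y => (M y).det) x := by
  simp only [Matrix.det_fin_three]
  fun_prop

theorem differentiableWithinAt_matrix_det {M : ℝ → Matrix (Fin 3) (Fin 3) ℝ} {t : ℝ} {s : Set ℝ}
    (hM : ∀ i j, DifferentiableWithinAt ℝ (fun y => M y i j) s t) :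
    DifferentiableWithinAt ℝ (fun y => (M y).det) s t := by
  simp only [Matrix.det_fin_three]
  fun_prop

theorem differentiableWithinAt_matrix_inv {M : ℝ → Matrix (Fin 3) (Fin 3) ℝ} {t : ℝ} {s : Set ℝ}
    (hM : ∀ i j, DifferentiableWithinAt ℝ (fun y => M y i j) s t) (h0 : IsUnit (M t).det)
    (i j : Fin 3) : DifferentiableWithinAt ℝ (fun y => (M y)⁻¹ i j) s t := by
  simp only [Matrix.inv_def, Ring.inverse_eq_inv', Matrix.smul_apply, smul_eq_mul,
    Matrix.adjugate_apply]
  refine ((differentiableWithinAt_matrix_det hM).inv h0.ne_zero).mul (differentiableWithinAt_matrix_det ?_)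
  intro k l
  simp only [Matrix.updateRow_apply]
  split_ifs
  · exact differentiableWithinAt_const _
  · exact hM k l

theorem eps_swap (i j k : Fin 3) : eps i j k = -eps i k j := by
  unfold eps; ring

/-- The contraction `ε_{ijk} Xₖⱼ`, i.e. the curl of a field whose gradient matrix is `X`. -/
def curlMat (i : Fin 3) (X : Matrix (Fin 3) (Fin 3) ℝ) : ℝ :=
  ∑ j, ∑ k, eps i j k * X k j

theorem curlMat_smul (i : Fin 3) (c : ℝ) (X : Matrix (Fin 3) (Fin 3) ℝ) :
    curlMat i (c • X) = c * curlMat i X := by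
  simp [curlMat, Finset.mul_sum, mul_left_comm]

theorem curlMat_sub (i : Fin 3) (X Y : Matrix (Fin 3) (Fin 3) ℝ) :
    curlMat i (X - Y) = curlMat i X - curlMat i Y := by
  simp [curlMat, mul_sub, Finset.sum_sub_distrib]

theorem curlMat_eq_zero_of_isSymm (i : Fin 3) {X : Matrix (Fin 3) (Fin 3) ℝ} (hX : X.IsSymm) :
    curlMat i X = 0 := by
  have h : curlMat i X = -curlMat i X := by
    conv_lhs => rw [curlMat, Finset.sum_comm]
    simp only [curlMat, ← Finset.sum_neg_distrib]
    refine Finset.sum_congr rfl fun j _ => Finset.sum_congr rfl fun k _ => ?_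
    rw [eps_swap i k j, hX.apply]; ring
  linarith

theorem sum_eps_mul_eq_neg_curlMat (i : Fin 3) (Y : Fin 3 → Fin 3 → ℝ) :
    ∑ k, ∑ j, eps i k j * Y k j = -curlMat i (Matrix.of Y) := by
  rw [Finset.sum_comm]
  simp only [curlMat, ← Finset.sum_neg_distrib]
  refine Finset.sum_congr rfl fun j _ => Finset.sum_congr rfl fun k _ => ?_
  rw [eps_swap i k j, Matrix.of_apply]; ring

theorem HasDerivWithinAt.curlMat {X : ℝ → Matrix (Fin 3) (Fin 3) ℝ}
    {X' : Matrix (Fin 3) (Fin 3) ℝ} {s : Set ℝ} {t : ℝ} (i : Fin 3)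
    (h : ∀ k j, HasDerivWithinAt (fun τ => X τ k j) (X' k j) s t) :
    HasDerivWithinAt (fun τ => curlMat i (X τ)) (_root_.curlMat i X') s t :=
  HasDerivWithinAt.fun_sum fun j _ => HasDerivWithinAt.fun_sum fun k _ => (h k j).const_mul _

theorem ContinuousOn.curlMat {X : ℝ → Matrix (Fin 3) (Fin 3) ℝ} {s : Set ℝ} (i : Fin 3)
    (h : ∀ k j, ContinuousOn (fun τ => X τ k j) s) :
    ContinuousOn (fun τ => curlMat i (X τ)) s :=
  continuousOn_finsetSum _ fun j _ => continuousOn_finsetSum _ fun k _ =>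
    continuousOn_const.mul (h k j)

theorem integral_curlMat {X : ℝ → Matrix (Fin 3) (Fin 3) ℝ} {a b : ℝ} (i : Fin 3)
    (h : ∀ k j, ContinuousOn (fun τ => X τ k j) (uIcc a b)) :
    ∫ τ in a..b, curlMat i (X τ) = curlMat i (Matrix.of fun k j => ∫ τ in a..b, X τ k j) := by
  have hi : ∀ k j, IntervalIntegrable (fun τ => eps i j k * X τ k j) MeasureTheory.volume a b :=
    fun k j => (continuousOn_const.mul (h k j)).intervalIntegrable
  simp only [curlMat, Matrix.of_apply]
  rw [intervalIntegral.integral_finsetSum]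
  · refine Finset.sum_congr rfl fun j _ => ?_
    rw [intervalIntegral.integral_finsetSum fun k _ => hi k j]
    simp only [intervalIntegral.integral_const_mul]
  · intro j _
    exact (continuousOn_finsetSum _ fun k _ =>
      continuousOn_const.mul (h k j)).intervalIntegrable

theorem hasDerivWithinAt_matrix_mul {P Q : ℝ → Matrix (Fin 3) (Fin 3) ℝ}
    {P' Q' : Matrix (Fin 3) (Fin 3) ℝ} {s : Set ℝ} {t : ℝ}
    (hP : ∀ i j, HasDerivWithinAt (fun τ => P τ i j) (P' i j) s t)
    (hQ : ∀ i j, HasDerivWithinAt (fun τ => Q τ i j) (Q' i j) s t) (i j : Fin 3) :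
    HasDerivWithinAt (fun τ => (P τ * Q τ) i j) ((P' * Q t + P t * Q') i j) s t := by
  simp only [Matrix.mul_apply, Matrix.add_apply, ← Finset.sum_add_distrib]
  exact HasDerivWithinAt.fun_sum fun k _ => (hP i k).fun_mul (hQ k j)

theorem continuousOn_matrix_mul {P Q : ℝ → Matrix (Fin 3) (Fin 3) ℝ} {s : Set ℝ}
    (hP : ∀ i j, ContinuousOn (fun τ => P τ i j) s)
    (hQ : ∀ i j, ContinuousOn (fun τ => Q τ i j) s) (i j : Fin 3) :
    ContinuousOn (fun τ => (P τ * Q τ) i j) s := by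
  simp only [Matrix.mul_apply]
  exact continuousOn_finsetSum _ fun k _ => (hP i k).mul (hQ k j)

theorem hasDerivWithinAt_matrix_inv {M : ℝ → Matrix (Fin 3) (Fin 3) ℝ}
    {M' : Matrix (Fin 3) (Fin 3) ℝ} {s : Set ℝ} {t : ℝ} (hs : UniqueDiffWithinAt ℝ s t)
    (ht : t ∈ s) (hM : ∀ i j, HasDerivWithinAt (fun τ => M τ i j) (M' i j) s t)
    (hdet : ∀ τ ∈ s, IsUnit (M τ).det) (i j : Fin 3) :
    HasDerivWithinAt (fun τ => (M τ)⁻¹ i j) ((-((M t)⁻¹ * M' * (M t)⁻¹)) i j) s t := by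
  set B : Matrix (Fin 3) (Fin 3) ℝ := Matrix.of fun i j => derivWithin (fun τ => (M τ)⁻¹ i j) s t
  have hB : ∀ i j, HasDerivWithinAt (fun τ => (M τ)⁻¹ i j) (B i j) s t := fun i j =>
    (differentiableWithinAt_matrix_inv (fun i j => (hM i j).differentiableWithinAt)
      (hdet t ht) i j).hasDerivWithinAt
  have h0 : M' * (M t)⁻¹ + M t * B = 0 := by
    ext k l
    refine hs.eq_deriv _ (hasDerivWithinAt_matrix_mul hM hB k l) ?_
    refine (hasDerivWithinAt_const t s ((1 : Matrix (Fin 3) (Fin 3) ℝ) k l)).congr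
      (fun τ hτ => ?_) ?_
    · rw [Matrix.mul_nonsing_inv _ (hdet τ hτ)]
    · rw [Matrix.mul_nonsing_inv _ (hdet t ht)]
  have h1 : B = -((M t)⁻¹ * M' * (M t)⁻¹) := by
    calc B = (M t)⁻¹ * (M t * B) := by
          rw [← Matrix.mul_assoc, Matrix.nonsing_inv_mul _ (hdet t ht), Matrix.one_mul]
      _ = _ := by rw [eq_neg_of_add_eq_zero_right h0, Matrix.mul_neg, Matrix.mul_assoc]
  rw [← h1]; exact hB i j

theorem isSymm_mul_inv {M B : Matrix (Fin 3) (Fin 3) ℝ} (hM : IsUnit M.det)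
    (h : (Mᵀ * B).IsSymm) : (B * M⁻¹).IsSymm := by
  have hT : IsUnit Mᵀ.det := by rwa [Matrix.det_transpose]
  have : B * M⁻¹ = (M⁻¹)ᵀ * (Mᵀ * B) * M⁻¹ := by
    rw [Matrix.transpose_nonsing_inv, ← Matrix.mul_assoc, Matrix.nonsing_inv_mul _ hT,
      Matrix.one_mul]
  rw [this, Matrix.IsSymm, Matrix.transpose_mul, Matrix.transpose_mul, h.eq,
    Matrix.transpose_transpose]
  simp only [Matrix.mul_assoc]

/-- If `∂_k f = ∑ᵢ ∂_k eᵢ Uᵢ` on the ball, then `∑ᵢ ∂_k eᵢ ∂_r Uᵢ` is symmetric in `k` and `r`. -/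
theorem sum_pd_mul_pd_comm {f : (Fin 3 → ℝ) → ℝ} {e U : Fin 3 → (Fin 3 → ℝ) → ℝ}
    {x : Fin 3 → ℝ} (hx : x ∈ ball3) (hf : ContDiffAt ℝ 2 f x)
    (he : ∀ i, ContDiffAt ℝ 2 (e i) x) (hU : ∀ i, DifferentiableAt ℝ (U i) x)
    (h : ∀ y ∈ ball3, ∀ k, pd k f y = ∑ i, pd k (e i) y * U i y) (k r : Fin 3) :
    ∑ i, pd k (e i) x * pd r (U i) x = ∑ i, pd r (e i) x * pd k (U i) x := by
  have hd : ∀ k i, DifferentiableAt ℝ (pd k (e i)) x := fun k i =>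
    (contDiffAt_pd (m := 1) (he i) (by norm_num) k).differentiableAt (by simp)
  have key : ∀ k r, pd r (pd k f) x
      = ∑ i, pd r (pd k (e i)) x * U i x + ∑ i, pd k (e i) x * pd r (U i) x := by
    intro k r
    rw [pd_congr hx (fun y hy => h y hy k) r, pd_sum fun i _ => (hd k i).fun_mul (hU i),
      ← Finset.sum_add_distrib]
    exact Finset.sum_congr rfl fun i _ => pd_mul (hd k i) (hU i) r
  have h1 := key k r
  have h2 := key r k
  have h3 : ∑ i, pd r (pd k (e i)) x * U i x = ∑ i, pd k (pd r (e i)) x * U i x :=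
    Finset.sum_congr rfl fun i _ => by rw [pd_pd_comm (he i)]
  rw [pd_pd_comm hf] at h1
  linarith

/-- The Lagrangian curl of a field balanced by a Lagrangian pressure gradient vanishes. -/
theorem isSymm_jac_mul_inv_of_balance {η : (Fin 3 → ℝ) → ℝ → Fin 3 → ℝ} {t : ℝ}
    {W : (Fin 3 → ℝ) → Fin 3 → ℝ} {x : Fin 3 → ℝ} (hx : x ∈ ball3)
    (he : ∀ i, ContDiffAt ℝ 3 (fun y => η y t i) x)
    (hW : ∀ i, DifferentiableAt ℝ (fun y => W y i) x)
    (hinv : ∀ y ∈ ball3, IsUnit (jacT η y t).det)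
    (h : ∀ y ∈ ball3, ∀ i, W y i + 2 * ∑ k, (jacT η y t)⁻¹ k i *
      pd k (fun z => dw z * ((jacT η z t).det)⁻¹) y = 0) :
    ((Matrix.of fun i k => pd k (fun y => W y i) x) * (jacT η x t)⁻¹).IsSymm := by
  set f : (Fin 3 → ℝ) → ℝ := fun z => dw z * ((jacT η z t).det)⁻¹ with hf
  have hfC : ContDiffAt ℝ 2 f x := by
    have hd : ContDiffAt ℝ 2 dw x := by
      have : ContDiff ℝ 2 dw := by unfold dw; fun_prop
      exact this.contDiffAt
    exact hd.mul ((contDiffAt_det fun i j =>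
      contDiffAt_pd (he i) (by norm_num) j).inv (hinv x hx).ne_zero)
  have hgrad : ∀ y ∈ ball3, ∀ k, pd k f y
      = ∑ i, pd k (fun z => η z t i) y * (-(1 / 2) * W y i) := by
    intro y hy k
    have hU : ∀ i, -(1 / 2) * W y i = ∑ l, (jacT η y t)⁻¹ l i * pd l f y := fun i => by
      linarith [h y hy i]
    have hmul : ∀ l, ∑ i, (jacT η y t)⁻¹ l i * jacT η y t i k
        = (1 : Matrix (Fin 3) (Fin 3) ℝ) l k := fun l => by
      rw [← Matrix.mul_apply, Matrix.nonsing_inv_mul _ (hinv y hy)]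
    calc pd k f y = ∑ l, (1 : Matrix (Fin 3) (Fin 3) ℝ) l k * pd l f y := by
          simp [Matrix.one_apply]
      _ = ∑ l, ∑ i, jacT η y t i k * ((jacT η y t)⁻¹ l i * pd l f y) := by
          refine Finset.sum_congr rfl fun l _ => ?_
          rw [← hmul l, Finset.sum_mul]
          exact Finset.sum_congr rfl fun i _ => by ring
      _ = ∑ i, jacT η y t i k * (-(1 / 2) * W y i) := by
          rw [Finset.sum_comm]
          exact Finset.sum_congr rfl fun i _ => by rw [hU, Finset.mul_sum]
  refine isSymm_mul_inv (hinv x hx) (Matrix.IsSymm.ext fun k r => ?_)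
  have hs := sum_pd_mul_pd_comm hx hfC (fun i => (he i).of_le (by norm_num))
    (fun i => (hW i).const_mul _) hgrad k r
  simp only [pd_const_mul _ (hW _)] at hs
  simp only [mul_left_comm _ (-(1 / 2) : ℝ), ← Finset.mul_sum] at hs
  simp only [Matrix.mul_apply, Matrix.transpose_apply, jacT, Matrix.of_apply]
  linarith

theorem jacT_eq_one {η : (Fin 3 → ℝ) → ℝ → Fin 3 → ℝ} {t : ℝ} {x : Fin 3 → ℝ} (hx : x ∈ ball3)
    (h : ∀ y ∈ ball3, η y t = y) : jacT η x t = 1 := by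
  ext i k
  rw [← pd_coord k i x, jacT, Matrix.of_apply]
  exact pd_congr hx (fun y hy => by rw [h y hy]) k

/-- Integration in time of the evolution law for `α² curl_η v`, in matrix form. -/
theorem curlMat_integral_identity {α α' : ℝ → ℝ} {M V Vt : ℝ → Matrix (Fin 3) (Fin 3) ℝ}
    (hαpos : ∀ t ∈ Ici (0 : ℝ), 0 < α t) (hα0 : α 0 = 1)
    (hα : ∀ t ∈ Ici (0 : ℝ), HasDerivWithinAt α (α' t) (Ici 0) t)
    (hM0 : M 0 = 1) (hdet : ∀ t ∈ Ici (0 : ℝ), IsUnit (M t).det)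
    (hM : ∀ t ∈ Ici (0 : ℝ), ∀ i j, HasDerivWithinAt (fun s => M s i j) (V t i j) (Ici 0) t)
    (hV : ∀ t ∈ Ici (0 : ℝ), ∀ i j, HasDerivWithinAt (fun s => V s i j) (Vt t i j) (Ici 0) t)
    (hsymm : ∀ t > (0 : ℝ), ((α t ^ 2 • Vt t + (2 * α t * α' t) • V t) * (M t)⁻¹).IsSymm)
    {t : ℝ} (ht : t ∈ Ici (0 : ℝ)) (i : Fin 3) :
    curlMat i (M t) = (∫ s in (0 : ℝ)..t, (α s ^ 2)⁻¹) * curlMat i (V 0)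
      - curlMat i (Matrix.of fun k j => ∫ s in (0 : ℝ)..t, (V s * ((M s)⁻¹ - 1)) k j)
      - curlMat i (Matrix.of fun k j => ∫ s in (0 : ℝ)..t, (α s ^ 2)⁻¹ *
          ∫ τ in (0 : ℝ)..s, α τ ^ 2 * (V τ * (M τ)⁻¹ * V τ * (M τ)⁻¹) k j) := by
  set N : ℝ → Matrix (Fin 3) (Fin 3) ℝ := fun τ => α τ ^ 2 • (V τ * (M τ)⁻¹ * V τ * (M τ)⁻¹)
    with hN
  have hA : ∀ t ∈ Ici (0 : ℝ), ∀ i j, HasDerivWithinAt (fun s => (M s)⁻¹ i j)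
      ((-((M t)⁻¹ * V t * (M t)⁻¹)) i j) (Ici 0) t := fun t ht =>
    hasDerivWithinAt_matrix_inv (uniqueDiffOn_Ici 0 t ht) ht (hM t ht) hdet
  have hαc : ContinuousOn α (Ici 0) := fun t ht => (hα t ht).continuousWithinAt
  have hα2c : ContinuousOn (fun s => (α s ^ 2)⁻¹) (Ici 0) :=
    (hαc.pow 2).inv₀ fun s hs => (pow_pos (hαpos s hs) 2).ne'
  have hVc : ∀ i j, ContinuousOn (fun s => V s i j) (Ici 0) := fun i j t ht =>
    (hV t ht i j).continuousWithinAt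
  have hAc : ∀ i j, ContinuousOn (fun s => (M s)⁻¹ i j) (Ici 0) := fun i j t ht =>
    (hA t ht i j).continuousWithinAt
  have hNc : ∀ k j, ContinuousOn (fun s => N s k j) (Ici 0) := fun k j =>
    (hαc.pow 2).mul (continuousOn_matrix_mul (continuousOn_matrix_mul
      (continuousOn_matrix_mul hVc hAc) hVc) hAc k j)
  have hsub : ∀ s ∈ Ici (0 : ℝ), uIcc 0 s ⊆ Ici 0 := fun s hs => by
    rw [uIcc_of_le hs]; exact Icc_subset_Ici_self
  set P : ℝ → Matrix (Fin 3) (Fin 3) ℝ :=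
    fun s => Matrix.of fun k j => ∫ τ in (0 : ℝ)..s, N τ k j with hP
  have hPc : ∀ s ∈ Ici (0 : ℝ), ∀ k j, ContinuousOn (fun s => P s k j) (uIcc 0 s) :=
    fun s hs k j => intervalIntegral.continuousOn_primitive_interval
      (((hNc k j).mono (hsub s hs)).integrableOn_compact isCompact_uIcc)
  have hVA : ∀ s ∈ Ici (0 : ℝ), ∀ k j, HasDerivWithinAt
      (fun s => (α s ^ 2 • (V s * (M s)⁻¹)) k j)
      (((α s ^ 2 • Vt s + (2 * α s * α' s) • V s) * (M s)⁻¹ - N s) k j) (Ici 0) s := by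
    intro s hs k j
    have h := ((hα s hs).fun_pow 2).fun_mul (hasDerivWithinAt_matrix_mul (hV s hs) (hA s hs) k j)
    refine h.congr_deriv ?_
    simp only [hN, Matrix.add_apply, Matrix.sub_apply, Matrix.smul_apply, smul_eq_mul,
      Matrix.add_mul, Matrix.smul_mul, Matrix.mul_neg, Matrix.neg_apply, Matrix.mul_assoc]
    push_cast
    ring
  have hH : ∀ s ∈ Ici (0 : ℝ),
      α s ^ 2 * curlMat i (V s * (M s)⁻¹) = curlMat i (V 0) - curlMat i (P s) := by
    intro s hs
    have hc : ∀ k j, ContinuousOn (fun s => (α s ^ 2 • (V s * (M s)⁻¹)) k j) (Ici 0) :=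
      fun k j s hs => (hVA s hs k j).continuousWithinAt
    have h := intervalIntegral.integral_eq_sub_of_hasDerivAt_of_le
      (f := fun s => curlMat i (α s ^ 2 • (V s * (M s)⁻¹))) (f' := fun s => -curlMat i (N s)) hs
      ((ContinuousOn.curlMat i hc).mono Icc_subset_Ici_self)
      (fun τ hτ => by
        have hd := (HasDerivWithinAt.curlMat i (hVA τ hτ.1.le)).hasDerivAt (Ici_mem_nhds hτ.1)
        rwa [curlMat_sub, curlMat_eq_zero_of_isSymm i (hsymm τ hτ.1), zero_sub] at hd)
      ((ContinuousOn.curlMat i hNc).mono (hsub s hs)).neg.intervalIntegrable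
    rw [intervalIntegral.integral_neg,
      integral_curlMat i fun k j => (hNc k j).mono (hsub s hs)] at h
    simp only [hα0, hM0, curlMat_smul, inv_one, Matrix.mul_one, one_pow, one_mul] at h
    linarith
  have hVeq : ∀ s ∈ Ici (0 : ℝ), curlMat i (V s) = (α s ^ 2)⁻¹ * curlMat i (V 0)
      - curlMat i (V s * ((M s)⁻¹ - 1)) - curlMat i ((α s ^ 2)⁻¹ • P s) := by
    intro s hs
    have hne : α s ^ 2 ≠ 0 := (pow_pos (hαpos s hs) 2).ne'
    have h2 : curlMat i (V s * (M s)⁻¹)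
        = (α s ^ 2)⁻¹ * (curlMat i (V 0) - curlMat i (P s)) := by
      rw [← hH s hs, inv_mul_cancel_left₀ hne]
    rw [Matrix.mul_sub, Matrix.mul_one, curlMat_sub, curlMat_smul, h2]
    ring
  have hBc : ∀ k j, ContinuousOn (fun s => (V s * ((M s)⁻¹ - 1)) k j) (uIcc 0 t) := fun k j =>
    (continuousOn_matrix_mul (Q := fun s => (M s)⁻¹ - 1) hVc
      (fun k j => (hAc k j).sub continuousOn_const) k j).mono (hsub t ht)
  have hCc : ∀ k j, ContinuousOn (fun s => ((α s ^ 2)⁻¹ • P s) k j) (uIcc 0 t) := fun k j =>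
    (hα2c.mono (hsub t ht)).mul (hPc t ht k j)
  have hac : ContinuousOn (fun s => (α s ^ 2)⁻¹ * curlMat i (V 0)) (uIcc 0 t) :=
    (hα2c.mono (hsub t ht)).mul continuousOn_const
  have habc : ContinuousOn (fun s => (α s ^ 2)⁻¹ * curlMat i (V 0)
      - curlMat i (V s * ((M s)⁻¹ - 1))) (uIcc 0 t) := hac.sub (ContinuousOn.curlMat i hBc)
  have hM1 := intervalIntegral.integral_eq_sub_of_hasDerivAt_of_le
    (f := fun s => curlMat i (M s)) (f' := fun s => curlMat i (V s)) ht
    (fun s hs => ((HasDerivWithinAt.curlMat i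
      (hM s hs.1)).continuousWithinAt).mono Icc_subset_Ici_self)
    (fun s hs => (HasDerivWithinAt.curlMat i (hM s hs.1.le)).hasDerivAt (Ici_mem_nhds hs.1))
    ((ContinuousOn.curlMat i hVc).mono (hsub t ht)).intervalIntegrable
  rw [intervalIntegral.integral_congr (fun s hs => hVeq s (hsub t ht hs)),
    intervalIntegral.integral_sub habc.intervalIntegrable
      (ContinuousOn.curlMat i hCc).intervalIntegrable,
    intervalIntegral.integral_sub hac.intervalIntegrable
      (ContinuousOn.curlMat i hBc).intervalIntegrable,
    intervalIntegral.integral_mul_const, integral_curlMat i hBc, integral_curlMat i hCc, hM0,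
    curlMat_eq_zero_of_isSymm i Matrix.isSymm_one, sub_zero] at hM1
  exact hM1.symm

/-- Integrated curl identity for the `γ = 2` momentum equation: with `β(t) = ∫₀ᵗ α⁻²` and
`δη = η − id`,
`(curl δη)ᵢ = β(t)(curl u₀)ᵢ + ε_{ikj} ∫₀ᵗ ∂_r vᵏ (Aʳⱼ − δʳⱼ) ds
 + ε_{ikj} ∫₀ᵗ α⁻² ∫₀ˢ α² ∂_r vᵏ Aʳₗ ∂_m vˡ Aᵐⱼ dτ ds`. -/
theorem stmt16 (α α' : ℝ → ℝ)
    (hαpos : ∀ t ∈ Ici (0 : ℝ), 0 < α t) (hα0 : α 0 = 1)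
    (hα : ∀ t ∈ Ici (0 : ℝ), HasDerivWithinAt α (α' t) (Ici 0) t)
    (hα'c : ContinuousOn α' (Ici 0))
    (η v vt : (Fin 3 → ℝ) → ℝ → Fin 3 → ℝ)
    (hη0 : ∀ x ∈ ball3, η x 0 = x)
    (hsmooth : ContDiffOn ℝ 3 (fun p : (Fin 3 → ℝ) × ℝ => η p.1 p.2) (ball3 ×ˢ Ici 0))
    (hv : ∀ x ∈ ball3, ∀ t ∈ Ici (0 : ℝ), HasDerivWithinAt (fun s => η x s) (v x t) (Ici 0) t)
    (hvt : ∀ x ∈ ball3, ∀ t ∈ Ici (0 : ℝ), HasDerivWithinAt (fun s => v x s) (vt x t) (Ici 0) t)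
    (hinv : ∀ x ∈ ball3, ∀ t ∈ Ici (0 : ℝ), IsUnit (jacT η x t).det)
    (hmom : ∀ x ∈ ball3, ∀ t > (0 : ℝ), ∀ i : Fin 3,
      α t ^ 5 * vt x t i + 2 * α t ^ 4 * α' t * v x t i + η x t i
        + 2 * ∑ k, (jacT η x t)⁻¹ k i *
            pd k (fun y => dw y * ((jacT η y t).det)⁻¹) x = 0) :
    ∀ t ∈ Ici (0 : ℝ), ∀ x ∈ ball3, ∀ i : Fin 3,
      (∑ j, ∑ k, eps i j k * pd j (fun y => η y t k - y k) x)
        = (∫ s in (0 : ℝ)..t, (α s ^ 2)⁻¹) *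
            (∑ j, ∑ k, eps i j k * pd j (fun y => v y 0 k) x)
          + (∑ k, ∑ j, eps i k j * ∫ s in (0 : ℝ)..t,
              ∑ r, pd r (fun y => v y s k) x *
                ((jacT η x s)⁻¹ r j - if r = j then (1 : ℝ) else 0))
          + ∑ k, ∑ j, eps i k j * ∫ s in (0 : ℝ)..t, (α s ^ 2)⁻¹ *
              ∫ τ in (0 : ℝ)..s, α τ ^ 2 *
                ∑ r, ∑ l, ∑ m, pd r (fun y => v y τ k) x * (jacT η x τ)⁻¹ r l *
                  pd m (fun y => v y τ l) x * (jacT η x τ)⁻¹ m j := by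
  intro t ht x hx i
  have hη3 : ∀ k, ContDiffOn ℝ 3 (fun p : (Fin 3 → ℝ) × ℝ => η p.1 p.2 k) (ball3 ×ˢ Ici 0) :=
    contDiffOn_pi.1 hsmooth
  have hvk : ∀ k, ∀ x ∈ ball3, ∀ t ∈ Ici (0 : ℝ),
      HasDerivWithinAt (fun s => η x s k) (v x t k) (Ici 0) t :=
    fun k x hx t ht => hasDerivWithinAt_pi.1 (hv x hx t ht) k
  have hvtk : ∀ k, ∀ x ∈ ball3, ∀ t ∈ Ici (0 : ℝ),
      HasDerivWithinAt (fun s => v x s k) (vt x t k) (Ici 0) t :=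
    fun k x hx t ht => hasDerivWithinAt_pi.1 (hvt x hx t ht) k
  have hv2 : ∀ k, ContDiffOn ℝ 2 (fun p : (Fin 3 → ℝ) × ℝ => v p.1 p.2 k) (ball3 ×ˢ Ici 0) :=
    fun k => contDiffOn_timeDeriv (f := fun x s => η x s k) (g := fun x s => v x s k)
      (hη3 k) (by norm_num) (hvk k)
  have hvt1 : ∀ k, ContDiffOn ℝ 1 (fun p : (Fin 3 → ℝ) × ℝ => vt p.1 p.2 k) (ball3 ×ˢ Ici 0) :=
    fun k => contDiffOn_timeDeriv (f := fun x s => v x s k) (g := fun x s => vt x s k)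
      (hv2 k) (by norm_num) (hvtk k)
  have hηd : ∀ s ∈ Ici (0 : ℝ), ∀ k, ContDiffAt ℝ 3 (fun y => η y s k) x := fun s hs k =>
    contDiffAt_slice (f := fun y s => η y s k) (hη3 k) hx hs
  have hvd : ∀ s ∈ Ici (0 : ℝ), ∀ k, DifferentiableAt ℝ (fun y => v y s k) x := fun s hs k =>
    (contDiffAt_slice (f := fun y s => v y s k) (hv2 k) hx hs).differentiableAt (by simp)
  have hvtd : ∀ s ∈ Ici (0 : ℝ), ∀ k, DifferentiableAt ℝ (fun y => vt y s k) x := fun s hs k =>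
    (contDiffAt_slice (f := fun y s => vt y s k) (hvt1 k) hx hs).differentiableAt (by simp)
  have hsymm : ∀ s > (0 : ℝ), ((α s ^ 2 • jacT vt x s + (2 * α s * α' s) • jacT v x s) *
      (jacT η x s)⁻¹).IsSymm := by
    intro s hs
    have hs' : s ∈ Ici (0 : ℝ) := hs.le
    have hη1 : ∀ k, DifferentiableAt ℝ (fun y => η y s k) x := fun k =>
      (hηd s hs' k).differentiableAt (by simp)
    have h := isSymm_jac_mul_inv_of_balance (η := η) (t := s)
      (W := fun y k => α s ^ 5 * vt y s k + 2 * α s ^ 4 * α' s * v y s k + η y s k)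
      hx (hηd s hs')
      (fun k => (((hvtd s hs' k).const_mul _).fun_add ((hvd s hs' k).const_mul _)).fun_add (hη1 k))
      (fun y hy => hinv y hy s hs') (fun y hy k => hmom y hy s hs k)
    have hgrad : (Matrix.of fun i k => pd k (fun y =>
        α s ^ 5 * vt y s i + 2 * α s ^ 4 * α' s * v y s i + η y s i) x)
        = α s ^ 3 • (α s ^ 2 • jacT vt x s + (2 * α s * α' s) • jacT v x s) + jacT η x s := by
      ext i k
      rw [Matrix.of_apply, pd_add (((hvtd s hs' i).const_mul _).fun_add
        ((hvd s hs' i).const_mul _)) (hη1 i),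
        pd_add ((hvtd s hs' i).const_mul _) ((hvd s hs' i).const_mul _),
        pd_const_mul _ (hvtd s hs' i), pd_const_mul _ (hvd s hs' i)]
      simp only [jacT, Matrix.add_apply, Matrix.smul_apply, Matrix.of_apply, smul_eq_mul]
      ring
    rw [hgrad, Matrix.add_mul, Matrix.mul_nonsing_inv _ (hinv x hx s hs'), Matrix.smul_mul] at h
    have h3 := (h.sub Matrix.isSymm_one).smul (α s ^ 3)⁻¹
    rwa [add_sub_cancel_right, smul_smul,
      inv_mul_cancel₀ (pow_pos (hαpos s hs') 3).ne', one_smul] at h3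
  have hmain := curlMat_integral_identity (M := jacT η x) (V := jacT v x) (Vt := jacT vt x)
    hαpos hα0 hα (jacT_eq_one hx hη0) (hinv x hx)
    (fun s hs k j => hasDerivWithinAt_pd (f := fun y s => η y s k) (g := fun y s => v y s k)
      ((hη3 k).of_le (by norm_num)) (hvk k) hx hs j)
    (fun s hs k j => hasDerivWithinAt_pd (f := fun y s => v y s k) (g := fun y s => vt y s k)
      (hv2 k) (hvtk k) hx hs j)
    hsymm ht i
  have hlhs : (∑ j, ∑ k, eps i j k * pd j (fun y => η y t k - y k) x)
      = curlMat i (jacT η x t) := by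
    rw [← sub_zero (curlMat i _), ← curlMat_eq_zero_of_isSymm i Matrix.isSymm_one, ← curlMat_sub]
    refine Finset.sum_congr rfl fun j _ => Finset.sum_congr rfl fun k _ => ?_
    rw [Matrix.sub_apply, ← pd_coord j k x]
    simp [pd, jacT, fderiv_fun_sub ((hηd t ht k).differentiableAt (by simp))
      (differentiableAt_apply k x)]
  have hquad : ∀ τ k j, ∑ r, ∑ l, ∑ m, pd r (fun y => v y τ k) x * (jacT η x τ)⁻¹ r l *
      pd m (fun y => v y τ l) x * (jacT η x τ)⁻¹ m j
      = (jacT v x τ * (jacT η x τ)⁻¹ * jacT v x τ * (jacT η x τ)⁻¹) k j := by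
    intro τ k j
    simp only [Matrix.mul_apply, Fin.sum_univ_three, jacT, Matrix.of_apply]
    ring
  rw [hlhs, hmain, sum_eps_mul_eq_neg_curlMat i (fun k j => ∫ s in (0 : ℝ)..t,
    ∑ r, pd r (fun y => v y s k) x * ((jacT η x s)⁻¹ r j - if r = j then (1 : ℝ) else 0)),
    sum_eps_mul_eq_neg_curlMat i (fun k j => ∫ s in (0 : ℝ)..t, (α s ^ 2)⁻¹ *
      ∫ τ in (0 : ℝ)..s, α τ ^ 2 * ∑ r, ∑ l, ∑ m, pd r (fun y => v y τ k) x *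
        (jacT η x τ)⁻¹ r l * pd m (fun y => v y τ l) x * (jacT η x τ)⁻¹ m j)]
  simp only [hquad, sub_eq_add_neg]
  rfl
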